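/- Fix a constant c > 0. Let G be a graph on n = 2^k vertices that has property P. Then W(Clique(G)) ≥ k²/9, i.e., the CNF Clique(G) has no resolution refutation in which every clause has width less than k²/9. -/

import Mathlib

open Classical
noncomputable section

/-- A clause: a finite set of literals, where a literal is a pair (variable, polarity). -/
abbrev Clause (V : Type) := Finset (V × Bool)

/-- A literal `(x, b)` is satisfied by assignment `a` iff `a x = b`. -/
def litSat {V : Type} (a : V → Bool) (l : V × Bool) : Prop := a l.1 = l.2

/-- A clause is satisfied if some literal in it is satisfied. -/
def clauseSat {V : Type} (a : V → Bool) (C : Clause V) : Prop := ∃ l ∈ C, litSat a l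

/-- A CNF formula: a set of clauses. -/
abbrev CNF (V : Type) := Set (Clause V)

/-- A CNF is satisfiable if some assignment satisfies all its clauses. -/
def Satisfiable {V : Type} (φ : CNF V) : Prop := ∃ a : V → Bool, ∀ C ∈ φ, clauseSat a C

/-- A resolution refutation of a CNF `φ`: a sequence of clauses, each either a clause of `φ`
or obtained from two earlier clauses `A ∨ x`, `B ∨ ¬x` by the resolution rule (yielding
`A ∨ B`), ending with the empty clause. -/
structure Refutation {V : Type} [DecidableEq V] (φ : CNF V) where
  clauses : List (Clause V)
  nonempty : clauses ≠ []
  valid : ∀ i : Fin clauses.length, clauses.get i ∈ φ ∨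
    ∃ j k : Fin clauses.length, j < i ∧ k < i ∧
      ∃ (x : V) (A B : Clause V),
        clauses.get j = insert (x, true) A ∧
        clauses.get k = insert (x, false) B ∧
        clauses.get i = A ∪ B
  last_empty : clauses.getLast nonempty = ∅

/-- The length of a refutation: the number of clauses in the sequence. -/
def Refutation.length {V : Type} [DecidableEq V] {φ : CNF V} (R : Refutation φ) : ℕ :=
  R.clauses.length

/-- The width of a refutation: the maximum width (number of literals) of a clause in it. -/
def Refutation.width {V : Type} [DecidableEq V] {φ : CNF V} (R : Refutation φ) : ℕ :=
  (R.clauses.map Finset.card).foldr max 0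

/-- `L(φ)`: minimum length of a resolution refutation of `φ` (`⊤` if none exists,
in particular if `φ` is satisfiable). -/
def resLength {V : Type} [DecidableEq V] (φ : CNF V) : ℕ∞ :=
  sInf {l : ℕ∞ | ∃ R : Refutation φ, (R.length : ℕ∞) = l}

/-- `W(φ)`: minimum over refutations of the maximum clause width. -/
def resWidth {V : Type} [DecidableEq V] (φ : CNF V) : ℕ :=
  sInf {w : ℕ | ∃ R : Refutation φ, R.width = w}

/-- Treelike resolution derivations of a clause from the clauses of `φ`. -/
inductive ResTree {V : Type} [DecidableEq V] (φ : CNF V) : Clause V → Type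
  | ax (C : Clause V) (h : C ∈ φ) : ResTree φ C
  | res (x : V) (A B : Clause V) :
      ResTree φ (insert (x, true) A) → ResTree φ (insert (x, false) B) → ResTree φ (A ∪ B)

/-- The length (number of clauses, i.e. nodes) of a treelike derivation. -/
def ResTree.size {V : Type} [DecidableEq V] {φ : CNF V} {C : Clause V} : ResTree φ C → ℕ
  | .ax _ _ => 1
  | .res _ _ _ t₁ t₂ => t₁.size + t₂.size + 1

/-! ### The Prover–Adversary game -/

/-- A Prover move: query a variable, or erase (forget) a stored value. -/
inductive PMove (V : Type)
  | query (x : V)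
  | forget (x : V)

/-- A history of the game: list of moves (most recent first) together with the
Adversary's answer for query moves. -/
abbrev History (V : Type) := List (PMove V × Option Bool)

/-- A Prover strategy: choose the next move given the history so far. -/
def ProverStrat (V : Type) := History V → PMove V

/-- An Adversary strategy: answer a queried variable, given the history so far. -/
def AdvStrat (V : Type) := History V → V → Bool

/-- The stored partial assignment (memory content) determined by a history. -/
def memOf {V : Type} [DecidableEq V] : History V → V → Option Bool
  | [] => fun _ => none
  | (PMove.query x, ans) :: h => Function.update (memOf h) x ans
  | (PMove.forget x, _) :: h => Function.update (memOf h) x none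

/-- The history after `t` rounds of play between strategies `P` and `A`. -/
def play {V : Type} (P : ProverStrat V) (A : AdvStrat V) : ℕ → History V
  | 0 => []
  | t + 1 =>
    let h := play P A t
    match P h with
    | PMove.query x => (PMove.query x, some (A h x)) :: h
    | PMove.forget x => (PMove.forget x, none) :: h

/-- Number of memory locations in use: number of variables with a stored value. -/
def memSize {V : Type} [Fintype V] [DecidableEq V] (h : History V) : ℕ :=
  (Finset.univ.filter fun x => (memOf h x).isSome).card

/-- The stored partial assignment falsifies clause `C`: every literal of `C` is
assigned and falsified. -/
def falsifies {V : Type} [DecidableEq V] (h : History V) (C : Clause V) : Prop :=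
  ∀ l ∈ C, memOf h l.1 = some (!l.2)

/-- The Prover has a strategy winning the game on `φ` while never storing more than `M`
values: against every Adversary, the memory stays within `M` and at some point the
stored partial assignment falsifies a clause of `φ`. -/
def ProverWinsWith {V : Type} [Fintype V] [DecidableEq V] (φ : CNF V) (M : ℝ) : Prop :=
  ∃ P : ProverStrat V, ∀ A : AdvStrat V,
    (∀ t, (memSize (play P A t) : ℝ) ≤ M) ∧ ∃ t, ∃ C ∈ φ, falsifies (play P A t) C

/-- The Adversary has a strategy winning against every Prover who uses at most `M`
memory locations: whenever the play keeps the memory within `M`, no clause of `φ` is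
ever falsified. -/
def AdversaryWinsAgainst {V : Type} [Fintype V] [DecidableEq V] (φ : CNF V) (M : ℝ) : Prop :=
  ∃ A : AdvStrat V, ∀ P : ProverStrat V,
    (∀ t, (memSize (play P A t) : ℝ) ≤ M) → ∀ t, ∀ C ∈ φ, ¬ falsifies (play P A t) C

/-! ### Ramsey graphs and the formulas `Ψ_G`, `Clique(G)` -/

/-- A graph on `n` vertices is `c`-Ramsey if no set of `c·log₂ n` vertices forms a clique
or an independent set. -/
def IsCRamsey (c : ℝ) {n : ℕ} (G : SimpleGraph (Fin n)) : Prop :=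
  ¬ ∃ T : Finset (Fin n), T.card = ⌈c * Real.logb 2 n⌉₊ ∧
      (G.IsClique (T : Set (Fin n)) ∨ Gᶜ.IsClique (T : Set (Fin n)))

/-- The number `ck` of indices. -/
def numIdx (c : ℝ) (k : ℕ) : ℕ := ⌈c * (k : ℕ)⌉₊

/-- Variables of the formula `Clique(G)`: bit `b` of the vertex assigned to index `i`. -/
abbrev CliqueVar (c : ℝ) (k : ℕ) := Fin (numIdx c k) × Fin k

/-- Variables of `Ψ_G`: the bit variables `x^i_b` together with the extra variable `y`. -/
abbrev PsiVar (c : ℝ) (k : ℕ) := CliqueVar c k ⊕ Unit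

/-- Bit `b` of the binary representation of vertex `v`. -/
def vbit {k : ℕ} (v : Fin (2 ^ k)) (b : Fin k) : Bool := Nat.testBit v.val b.val

/-- The clause `⋁_b (x^i_b ≠ v_b)`, saying that index `i` is not mapped to vertex `v`. -/
def neqClause (c : ℝ) (k : ℕ) (i : Fin (numIdx c k)) (v : Fin (2 ^ k)) :
    Clause (CliqueVar c k) :=
  Finset.univ.image fun b : Fin k => (((i, b) : CliqueVar c k), ! vbit v b)

/-- The CNF `Clique(G)`: injectivity clauses, plus for each non-edge `{u,v}` and distinct
indices `i,j` the clause `⋁_b (x^i_b ≠ u_b) ∨ ⋁_b (x^j_b ≠ v_b)`.  It is satisfiable iff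
`G` has a clique of size `ck`. -/
def CliqueCNF (c : ℝ) {k : ℕ} (G : SimpleGraph (Fin (2 ^ k))) : CNF (CliqueVar c k) :=
  {C | (∃ i j : Fin (numIdx c k), i ≠ j ∧ ∃ v : Fin (2 ^ k),
          C = neqClause c k i v ∪ neqClause c k j v) ∨
       (∃ i j : Fin (numIdx c k), i ≠ j ∧ ∃ u v : Fin (2 ^ k), u ≠ v ∧ ¬ G.Adj u v ∧
          C = neqClause c k i u ∪ neqClause c k j v)}

/-- Lift a clause on the bit variables to the variable set of `Ψ_G`. -/
def liftClause {c : ℝ} {k : ℕ} (C : Clause (CliqueVar c k)) : Clause (PsiVar c k) :=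
  C.image fun l => (Sum.inl l.1, l.2)

/-- The CNF `Ψ_G`: (1) injectivity clauses; (2) for each edge `{u,v}` and distinct `i,j`
the clause `y ∨ ⋁_b (x^i_b ≠ u_b) ∨ ⋁_b (x^j_b ≠ v_b)`; (3) for each non-edge `{u,v}` and
distinct `i,j` the clause `¬y ∨ ⋁_b (x^i_b ≠ u_b) ∨ ⋁_b (x^j_b ≠ v_b)`. -/
def PsiCNF (c : ℝ) {k : ℕ} (G : SimpleGraph (Fin (2 ^ k))) : CNF (PsiVar c k) :=
  {C | (∃ i j : Fin (numIdx c k), i ≠ j ∧ ∃ v : Fin (2 ^ k),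
          C = liftClause (neqClause c k i v ∪ neqClause c k j v)) ∨
       (∃ i j : Fin (numIdx c k), i ≠ j ∧ ∃ u v : Fin (2 ^ k), G.Adj u v ∧
          C = insert (Sum.inr (), true)
                (liftClause (neqClause c k i u ∪ neqClause c k j v))) ∨
       (∃ i j : Fin (numIdx c k), i ≠ j ∧ ∃ u v : Fin (2 ^ k), u ≠ v ∧ ¬ G.Adj u v ∧
          C = insert (Sum.inr (), false)
                (liftClause (neqClause c k i u ∪ neqClause c k j v)))}

/-! ### Property P, density, probability -/

/-- Property P: for every `U ⊆ V(G)` with `|U| ≤ k/3` and every pattern `p` with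
`|p| ≤ k/3`, some common neighbour of `U` is consistent with `p`.  A pattern is a partial
assignment `p : Fin k → Option Bool` of the `k` bits; its size is the number of assigned
bits. -/
def PropertyP {k : ℕ} (G : SimpleGraph (Fin (2 ^ k))) : Prop :=
  ∀ U : Finset (Fin (2 ^ k)), 3 * U.card ≤ k →
    ∀ p : Fin k → Option Bool, 3 * (Finset.univ.filter fun b => (p b).isSome).card ≤ k →
      ∃ v : Fin (2 ^ k), (∀ u ∈ U, G.Adj u v) ∧
        ∀ (b : Fin k) (bit : Bool), p b = some bit → vbit v b = bit

/-- The mutual density `d(A,B) = e(A,B)/(|A|·|B|)`, where `e(A,B)` is the number of pairs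
`(a,b) ∈ A × B` with `{a,b}` an edge. -/
def density {α : Type} (G : SimpleGraph α) (A B : Finset α) : ℝ :=
  (((A ×ˢ B).filter fun ab => G.Adj ab.1 ab.2).card : ℝ) / ((A.card : ℝ) * (B.card : ℝ))

/-- The probability of the event `P` under the uniform distribution on a finite type;
the uniform distribution on `SimpleGraph (Fin n)` is exactly `G(n, 1/2)`. -/
def probOf {α : Type} [Fintype α] (P : α → Prop) : ℝ :=
  ((Finset.univ.filter P).card : ℝ) / (Fintype.card α : ℝ)

/-! ### The unary formula `Ψ'_G` -/

/-- Variables of the unary formula `Ψ'_G`: variables `p^i_v` for `i ∈ [c·log₂ n]`,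
`v ∈ V(G)`, plus the extra variable `y`. -/
abbrev UnaryVar (c : ℝ) (n : ℕ) := (Fin ⌈c * Real.logb 2 n⌉₊ × Fin n) ⊕ Unit

/-- The unary CNF `Ψ'_G`: each index is mapped to exactly one vertex, the map is
injective, and (depending on `y`) the image is a clique or an independent set. -/
def PsiUnary (c : ℝ) {n : ℕ} (G : SimpleGraph (Fin n)) : CNF (UnaryVar c n) :=
  {C | (∃ i : Fin ⌈c * Real.logb 2 n⌉₊,
          C = Finset.univ.image fun v : Fin n => ((Sum.inl (i, v) : UnaryVar c n), true)) ∨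
       (∃ i : Fin ⌈c * Real.logb 2 n⌉₊, ∃ u v : Fin n, u ≠ v ∧
          C = {((Sum.inl (i, u) : UnaryVar c n), false), (Sum.inl (i, v), false)}) ∨
       (∃ i j : Fin ⌈c * Real.logb 2 n⌉₊, i ≠ j ∧ ∃ v : Fin n,
          C = {((Sum.inl (i, v) : UnaryVar c n), false), (Sum.inl (j, v), false)}) ∨
       (∃ i j : Fin ⌈c * Real.logb 2 n⌉₊, i ≠ j ∧ ∃ u v : Fin n, G.Adj u v ∧
          C = {((Sum.inr () : UnaryVar c n), true), (Sum.inl (i, u), false),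
               (Sum.inl (j, v), false)}) ∨
       (∃ i j : Fin ⌈c * Real.logb 2 n⌉₊, i ≠ j ∧ ∃ u v : Fin n, u ≠ v ∧ ¬ G.Adj u v ∧
          C = {((Sum.inr () : UnaryVar c n), false), (Sum.inl (i, u), false),
               (Sum.inl (j, v), false)})}

end

/-- Bits of index `i` occurring in the variable set `S`. -/
noncomputable def cwBits {c : ℝ} {k : ℕ} (S : Finset (CliqueVar c k)) (i : Fin (numIdx c k)) :
    Finset (Fin k) := Finset.univ.filter fun b => (i, b) ∈ S

/-- Index `i` is heavy for `S` if at least `k/3` of its bits occur. -/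
def cwHeavy {c : ℝ} {k : ℕ} (S : Finset (CliqueVar c k)) (i : Fin (numIdx c k)) : Prop :=
  k ≤ 3 * (cwBits S i).card

/-- Heavy indices are mapped to pairwise adjacent vertices. -/
def cwGood {c : ℝ} {k : ℕ} (G : SimpleGraph (Fin (2 ^ k))) (S : Finset (CliqueVar c k))
    (a : CliqueVar c k → Bool) (f : Fin (numIdx c k) → Fin (2 ^ k)) : Prop :=
  (∀ i, cwHeavy S i → ∀ b, a (i, b) = vbit (f i) b) ∧
  ∀ i j, cwHeavy S i → cwHeavy S j → i ≠ j → G.Adj (f i) (f j)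

theorem cwHeavy_mono {c : ℝ} {k : ℕ} {S T : Finset (CliqueVar c k)} (h : S ⊆ T)
    {i : Fin (numIdx c k)} (hi : cwHeavy S i) : cwHeavy T i := by
  unfold cwHeavy at *
  have : (cwBits S i).card ≤ (cwBits T i).card := by
    apply Finset.card_le_card
    intro b hb
    simp only [cwBits, Finset.mem_filter, Finset.mem_univ, true_and] at *
    exact h hb
  omega

theorem cwHeavy_insert_ne {c : ℝ} {k : ℕ} {S : Finset (CliqueVar c k)} {x : CliqueVar c k}
    {i : Fin (numIdx c k)} (hne : i ≠ x.1) (hi : cwHeavy (insert x S) i) : cwHeavy S i := by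
  unfold cwHeavy at *
  have : cwBits (insert x S) i = cwBits S i := by
    ext b
    simp only [cwBits, Finset.mem_filter, Finset.mem_univ, true_and, Finset.mem_insert]
    constructor
    · rintro (h | h)
      · exact absurd (by rw [← h]) hne
      · exact h
    · exact Or.inr
  rwa [this] at hi

theorem cwGood_mono {c : ℝ} {k : ℕ} {G : SimpleGraph (Fin (2 ^ k))} {S T : Finset (CliqueVar c k)}
    {a : CliqueVar c k → Bool} {f : Fin (numIdx c k) → Fin (2 ^ k)} (h : S ⊆ T)
    (hT : cwGood G T a f) : cwGood G S a f :=
  ⟨fun i hi => hT.1 i (cwHeavy_mono h hi),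
   fun i j hi hj => hT.2 i j (cwHeavy_mono h hi) (cwHeavy_mono h hj)⟩

theorem cw_heavy_card {c : ℝ} {k : ℕ} (S : Finset (CliqueVar c k)) (hS : 9 * S.card < k ^ 2) :
    3 * (Finset.univ.filter fun i => cwHeavy S i).card ≤ k := by
  have h1 : ∑ i, (cwBits S i).card ≤ S.card := by
    rw [← Finset.card_sigma]
    apply Finset.card_le_card_of_injOn (fun y => (y.1, y.2))
    · intro y hy
      simpa [cwBits] using hy
    · rintro ⟨i, b⟩ _ ⟨j, d⟩ _ h
      simp only [Prod.mk.injEq] at h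
      obtain ⟨rfl, rfl⟩ := h
      rfl
  have h2 : (Finset.univ.filter fun i => cwHeavy S i).card * k ≤
      ∑ i ∈ Finset.univ.filter (fun i => cwHeavy S i), 3 * (cwBits S i).card := by
    rw [← smul_eq_mul]
    apply Finset.card_nsmul_le_sum
    intro i hi
    exact (Finset.mem_filter.mp hi).2
  have h3 : ∑ i ∈ Finset.univ.filter (fun i => cwHeavy S i), 3 * (cwBits S i).card ≤
      ∑ i, 3 * (cwBits S i).card :=
    Finset.sum_le_sum_of_subset (Finset.filter_subset _ _)
  have h4 : ∑ i, 3 * (cwBits S i).card = 3 * ∑ i, (cwBits S i).card := by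
    rw [Finset.mul_sum]
  by_contra hcon
  push Not at hcon
  nlinarith

theorem cw_extend {c : ℝ} {k : ℕ} {G : SimpleGraph (Fin (2 ^ k))} (hG : PropertyP G)
    (S : Finset (CliqueVar c k)) (hS : 9 * S.card < k ^ 2)
    (a : CliqueVar c k → Bool) (f : Fin (numIdx c k) → Fin (2 ^ k)) (h : cwGood G S a f)
    (x : CliqueVar c k) :
    ∃ a' f', (∀ y ∈ S, a' y = a y) ∧ cwGood G (insert x S) a' f' := by
  by_cases hx : cwHeavy S x.1
  · refine ⟨a, f, fun _ _ => rfl, ?_⟩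
    have key : ∀ i, cwHeavy (insert x S) i → cwHeavy S i := by
      intro i hi
      by_cases hne : i = x.1
      · rw [hne]; exact hx
      · exact cwHeavy_insert_ne hne hi
    exact ⟨fun i hi => h.1 i (key i hi), fun i j hi hj => h.2 i j (key i hi) (key j hj)⟩
  · obtain ⟨v, hv1, hv2⟩ := hG ((Finset.univ.filter fun i => cwHeavy S i).image f)
      (le_trans (Nat.mul_le_mul_left 3 Finset.card_image_le) (cw_heavy_card S hS))
      (fun b => if (x.1, b) ∈ S then some (a (x.1, b)) else none)
      (by
        have : (Finset.univ.filter fun b =>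
            (if (x.1, b) ∈ S then some (a (x.1, b)) else none).isSome) = cwBits S x.1 := by
          ext b
          simp only [cwBits, Finset.mem_filter, Finset.mem_univ, true_and]
          split_ifs with hb <;> simp [hb]
        rw [this]
        unfold cwHeavy at hx
        omega)
    have hvU : ∀ i, cwHeavy S i → G.Adj (f i) v := fun i hi =>
      hv1 _ (Finset.mem_image_of_mem f (by simpa using hi))
    refine ⟨fun y => if y.1 = x.1 then vbit v y.2 else a y,
      fun i => if i = x.1 then v else f i, ?_, ?_, ?_⟩
    · rintro ⟨i, b⟩ hy
      by_cases hi : i = x.1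
      · subst hi
        simp only [if_true]
        exact hv2 b _ (by rw [if_pos hy])
      · simp [hi]
    · intro i hi b
      by_cases hne : i = x.1
      · simp [hne]
      · simp only [hne, if_false]
        exact h.1 i (cwHeavy_insert_ne hne hi) b
    · intro i j hi hj hij
      by_cases hi' : i = x.1
      · have hj' : j ≠ x.1 := fun e => hij (hi'.trans e.symm)
        simp only [hi', hj', if_true, if_false]
        exact (hvU j (cwHeavy_insert_ne hj' hj)).symm
      · by_cases hj' : j = x.1
        · simp only [hi', hj', if_true, if_false]
          exact hvU i (cwHeavy_insert_ne hi' hi)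
        · simp only [hi', hj', if_false]
          exact h.2 i j (cwHeavy_insert_ne hi' hi) (cwHeavy_insert_ne hj' hj) hij

/-- The adversary's invariant: some good assignment falsifies `C`. -/
def cwInv {c : ℝ} {k : ℕ} (G : SimpleGraph (Fin (2 ^ k))) (C : Clause (CliqueVar c k)) : Prop :=
  ∃ a f, (∀ l ∈ C, a l.1 ≠ l.2) ∧ cwGood G (C.image Prod.fst) a f

theorem vbit_inj {k : ℕ} {u v : Fin (2 ^ k)} (h : ∀ b, vbit u b = vbit v b) : u = v := by
  apply Fin.ext
  apply Nat.eq_of_testBit_eq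
  intro i
  by_cases hi : i < k
  · exact h ⟨i, hi⟩
  · have hp : 2 ^ k ≤ 2 ^ i := Nat.pow_le_pow_right (by norm_num) (by omega)
    rw [Nat.testBit_lt_two_pow (lt_of_lt_of_le u.2 hp),
      Nat.testBit_lt_two_pow (lt_of_lt_of_le v.2 hp)]

theorem cw_row {c : ℝ} {k : ℕ} {G : SimpleGraph (Fin (2 ^ k))} {C : Clause (CliqueVar c k)}
    {a : CliqueVar c k → Bool} {f : Fin (numIdx c k) → Fin (2 ^ k)}
    (h1 : ∀ l ∈ C, a l.1 ≠ l.2) (h2 : cwGood G (C.image Prod.fst) a f)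
    {i : Fin (numIdx c k)} {u : Fin (2 ^ k)} (hs : neqClause c k i u ⊆ C) :
    cwHeavy (C.image Prod.fst) i ∧ f i = u := by
  have hm : ∀ b, ((i, b), ! vbit u b) ∈ C := fun b => hs (by
    unfold neqClause
    exact Finset.mem_image_of_mem _ (Finset.mem_univ b))
  have hh : cwHeavy (C.image Prod.fst) i := by
    have : cwBits (C.image Prod.fst) i = Finset.univ := by
      ext b
      simp only [cwBits, Finset.mem_filter, Finset.mem_univ, true_and, iff_true]
      exact Finset.mem_image_of_mem Prod.fst (hm b)
    unfold cwHeavy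
    rw [this, Finset.card_univ, Fintype.card_fin]
    omega
  refine ⟨hh, vbit_inj fun b => ?_⟩
  rw [← h2.1 i hh b]
  have := h1 _ (hm b)
  simpa using this

theorem cw_initial_case {c : ℝ} {k : ℕ} {G : SimpleGraph (Fin (2 ^ k))} {C : Clause (CliqueVar c k)}
    (hC : C ∈ CliqueCNF c G) : ¬ cwInv G C := by
  rintro ⟨a, f, h1, h2⟩
  rcases hC with ⟨i, j, hij, v, hC⟩ | ⟨i, j, hij, u, v, -, hna, hC⟩
  · obtain ⟨hi, ei⟩ := cw_row h1 h2 (i := i) (u := v) (hC ▸ Finset.subset_union_left)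
    obtain ⟨hj, ej⟩ := cw_row h1 h2 (i := j) (u := v) (hC ▸ Finset.subset_union_right)
    exact (h2.2 i j hi hj hij).ne (ei.trans ej.symm)
  · obtain ⟨hi, ei⟩ := cw_row h1 h2 (i := i) (u := u) (hC ▸ Finset.subset_union_left)
    obtain ⟨hj, ej⟩ := cw_row h1 h2 (i := j) (u := v) (hC ▸ Finset.subset_union_right)
    exact hna (ei ▸ ej ▸ h2.2 i j hi hj hij)

theorem cw_step {c : ℝ} {k : ℕ} {G : SimpleGraph (Fin (2 ^ k))} (hG : PropertyP G)
    {C A B P Q : Clause (CliqueVar c k)} {x : CliqueVar c k} (hw : 9 * C.card < k ^ 2)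
    (hA : A ⊆ C) (hB : B ⊆ C)
    (hP : ∀ l, l ∈ P → l = (x, true) ∨ l ∈ A) (hQ : ∀ l, l ∈ Q → l = (x, false) ∨ l ∈ B)
    (hC : cwInv G C) : cwInv G P ∨ cwInv G Q := by
  obtain ⟨a, f, h1, h2⟩ := hC
  obtain ⟨a', f', ha, hg⟩ := cw_extend hG (C.image Prod.fst)
    (lt_of_le_of_lt (Nat.mul_le_mul_left 9 Finset.card_image_le) hw) a f h2 x
  have hf : ∀ l ∈ C, a' l.1 ≠ l.2 := fun l hl => by
    rw [ha l.1 (Finset.mem_image_of_mem Prod.fst hl)]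
    exact h1 l hl
  have build : ∀ (D E : Clause (CliqueVar c k)) (t : Bool), E ⊆ C →
      (∀ l, l ∈ D → l = (x, t) ∨ l ∈ E) → a' x ≠ t → cwInv G D := by
    intro D E t hE hD ht
    refine ⟨a', f', ?_, cwGood_mono ?_ hg⟩
    · intro l hl
      rcases hD l hl with rfl | h
      · exact ht
      · exact hf l (hE h)
    · intro y hy
      obtain ⟨l, hl, rfl⟩ := Finset.mem_image.mp hy
      rcases hD l hl with rfl | h
      · exact Finset.mem_insert_self _ _
      · exact Finset.mem_insert_of_mem (Finset.mem_image_of_mem Prod.fst (hE h))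
  cases hx : a' x
  · left
    exact build P A true hA hP (by simp [hx])
  · right
    exact build Q B false hB hQ (by simp [hx])

theorem cw_foldr_max {l : List ℕ} {m : ℕ} (h : m ∈ l) : m ≤ l.foldr max 0 := by
  induction l with
  | nil => simp at h
  | cons y t ih =>
    simp only [List.foldr_cons]
    rcases List.mem_cons.mp h with rfl | h
    · exact le_max_left _ _
    · exact le_trans (ih h) (le_max_right _ _)

/-- Fix `c > 0` and let `G` be a graph on `n = 2^k` vertices with
property P. Then `W(Clique(G)) ≥ k²/9`: the CNF `Clique(G)` has no resolution refutation
in which every clause has width less than `k²/9`. -/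
theorem clique_width_lower_bound_propertyP (c : ℝ) (hc : 0 < c) (k : ℕ)
    (G : SimpleGraph (Fin (2 ^ k))) (hG : PropertyP G) :
    ∀ R : Refutation (CliqueCNF c G), (k : ℝ) ^ 2 / 9 ≤ (R.width : ℝ) := by
  intro R
  by_contra hcon
  push Not at hcon
  have hlt : 9 * R.width < k ^ 2 := by
    have : (9 * R.width : ℝ) < (k : ℝ) ^ 2 := by linarith
    exact_mod_cast this
  have hw : ∀ C ∈ R.clauses, 9 * C.card < k ^ 2 := by
    intro C hC
    have : C.card ≤ R.width := cw_foldr_max (List.mem_map_of_mem hC)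
    omega
  have main : ∀ m : ℕ, ∀ i : Fin R.clauses.length, i.val = m → ¬ cwInv G (R.clauses.get i) := by
    intro m
    induction m using Nat.strong_induction_on with
    | _ m ih =>
      intro i him hinv
      rcases R.valid i with hax | ⟨p, q, hp, hq, x, A, B, eP, eQ, eC⟩
      · exact cw_initial_case hax hinv
      · rcases cw_step hG (A := A) (B := B) (P := R.clauses.get p) (Q := R.clauses.get q) (x := x)
          (hw _ (List.get_mem _ _))
          (by rw [eC]; exact Finset.subset_union_left)
          (by rw [eC]; exact Finset.subset_union_right)
          (fun l hl => by rw [eP] at hl; exact Finset.mem_insert.mp hl)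
          (fun l hl => by rw [eQ] at hl; exact Finset.mem_insert.mp hl) hinv with h | h
        · exact ih p.val (him ▸ hp) p rfl h
        · exact ih q.val (him ▸ hq) q rfl h
  have hkpos : 0 < k := by
    rcases Nat.eq_zero_or_pos k with h | h
    · subst h; simp at hlt
    · exact h
  obtain ⟨i, hi⟩ := List.get_of_mem (List.getLast_mem R.nonempty)
  apply main i.val i rfl
  rw [hi, R.last_empty]
  have hno : ∀ i : Fin (numIdx c k),
      ¬ cwHeavy ((∅ : Clause (CliqueVar c k)).image Prod.fst) i := by
    intro i h
    simp [cwHeavy, cwBits] at h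
    omega
  exact ⟨fun _ => false, fun _ => ⟨0, by positivity⟩, by simp,
    fun i h => absurd h (hno i), fun i j h => absurd h (hno i)⟩
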